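/- Fix reals a > 0 and S > 0. For each sufficiently small ε > 0, let x(ε) ∈ [0,1) be the unique solution of g(x(ε)) = (1/12)(1 − a^4 ε^4/36). Then lim_{ε→0⁺} ( R_{⌊S/ε⌋}(x(ε)) − 2 ) / ε^2 = r(S,a), where r(S,a) = −a^2 (1 + 10 e^{−aS} + e^{−2aS}) / (3 (1 − e^{−aS})^2). -/

import Mathlib

open Filter

/-- The map `g(x) = x(1+x+x²)/(1+4x+x²)²`. -/
noncomputable def gfun (x : ℝ) : ℝ := x * (1 + x + x ^ 2) / (1 + 4 * x + x ^ 2) ^ 2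

/-- `R_s(x)`. -/
noncomputable def Rfun (s : ℕ) (x : ℝ) : ℝ :=
  ((1 + 4 * x + x ^ 2) / (1 + x + x ^ 2)) *
    ((1 - x ^ s) * (1 - x ^ (s + 3))) / ((1 - x ^ (s + 1)) * (1 - x ^ (s + 2)))

/-- Scaling limit: if `x(ε) ∈ [0,1)` solves `g(x(ε)) = (1/12)(1 − a⁴ε⁴/36)` for small `ε > 0`,
then `(R_{⌊S/ε⌋}(x(ε)) − 2)/ε² → r(S,a) = −a²(1 + 10e^{−aS} + e^{−2aS})/(3(1 − e^{−aS})²)`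
as `ε → 0⁺`. -/
theorem Rfun_scaling_limit (a S : ℝ) (ha : 0 < a) (hS : 0 < S) (xf : ℝ → ℝ)
    (hxf : ∀ᶠ ε in nhdsWithin 0 (Set.Ioi (0:ℝ)),
      xf ε ∈ Set.Ico (0:ℝ) 1 ∧ gfun (xf ε) = (1/12) * (1 - a ^ 4 * ε ^ 4 / 36)) :
    Tendsto (fun ε : ℝ => (Rfun ⌊S / ε⌋₊ (xf ε) - 2) / ε ^ 2)
      (nhdsWithin 0 (Set.Ioi (0:ℝ)))
      (nhds (-(a ^ 2 * (1 + 10 * Real.exp (-a * S) + Real.exp (-2 * a * S))) /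
        (3 * (1 - Real.exp (-a * S)) ^ 2))) := by
  set l := nhdsWithin (0:ℝ) (Set.Ioi (0:ℝ)) with hl
  have hpos : ∀ᶠ ε in l, 0 < ε := eventually_mem_nhdsWithin
  have hε0 : Tendsto (fun ε : ℝ => ε) l (nhds 0) := tendsto_id.mono_left nhdsWithin_le_nhds
  have key : ∀ᶠ ε in l, (1 - xf ε) ^ 2 = a ^ 2 * ε ^ 2 / 6 * (1 + 4 * xf ε + xf ε ^ 2) := by
    filter_upwards [hxf, hpos] with ε h hε
    obtain ⟨⟨h0, h1⟩, hg⟩ := h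
    generalize xf ε = x at *
    have hq : 0 < 1 + 4 * x + x ^ 2 := by positivity
    unfold gfun at hg
    rw [div_eq_iff (by positivity)] at hg
    have h4 : ((1 - x) ^ 2) ^ 2 = (a ^ 2 * ε ^ 2 / 6 * (1 + 4 * x + x ^ 2)) ^ 2 := by
      linear_combination (-12) * hg
    exact (pow_left_inj₀ (by positivity) (by positivity) two_ne_zero).1 h4
  have hd0 : Tendsto (fun ε => 1 - xf ε) l (nhds 0) := by
    have hu : Tendsto (fun ε : ℝ => a * ε) l (nhds 0) := by
      simpa using hε0.const_mul a
    refine tendsto_of_tendsto_of_tendsto_of_le_of_le' tendsto_const_nhds hu ?_ ?_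
    · filter_upwards [hxf] with ε h
      linarith [h.1.2]
    · filter_upwards [hxf, hpos, key] with ε h hε hk
      obtain ⟨⟨h0, h1⟩, -⟩ := h
      refine le_of_sq_le_sq ?_ (by positivity)
      rw [hk]
      have : 1 + 4 * xf ε + xf ε ^ 2 ≤ 6 := by nlinarith
      have h2 : 0 ≤ a ^ 2 * ε ^ 2 := by positivity
      nlinarith
  have hx1 : Tendsto xf l (nhds 1) := by
    have := hd0.const_sub 1
    simpa using this
  have hq : Tendsto (fun ε => 1 + 4 * xf ε + xf ε ^ 2) l (nhds 6) := by
    have := ((hx1.const_mul 4).const_add 1).add (hx1.pow 2)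
    convert this using 2; norm_num
  have hp : Tendsto (fun ε => 1 + xf ε + xf ε ^ 2) l (nhds 3) := by
    have := (hx1.const_add 1).add (hx1.pow 2)
    convert this using 2; norm_num
  have hd2 : Tendsto (fun ε => (1 - xf ε) ^ 2 / ε ^ 2) l (nhds (a ^ 2)) := by
    have h := hq.const_mul (a ^ 2 / 6)
    rw [show a ^ 2 / 6 * 6 = a ^ 2 by ring] at h
    refine h.congr' ?_
    filter_upwards [hpos, key] with ε hε hk
    rw [hk]; field_simp
  have hd1 : Tendsto (fun ε => (1 - xf ε) / ε) l (nhds a) := by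
    have h := hd2.sqrt
    rw [Real.sqrt_sq ha.le] at h
    refine h.congr' ?_
    filter_upwards [hpos, hxf] with ε hε hk
    rw [← div_pow, Real.sqrt_sq]
    exact div_nonneg (by linarith [hk.1.2]) hε.le
  have hxpos : ∀ᶠ ε in l, 0 < xf ε := hx1.eventually (lt_mem_nhds one_pos)
  have hlog : Tendsto (fun ε => Real.log (xf ε) / ε) l (nhds (-a)) := by
    have hs : Tendsto (slope Real.log 1) (nhdsWithin 1 {1}ᶜ) (nhds 1) := by
      have := (hasDerivAt_iff_tendsto_slope.1 (Real.hasDerivAt_log one_ne_zero))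
      simpa using this
    have hx1' : Tendsto xf l (nhdsWithin 1 {1}ᶜ) := by
      refine tendsto_nhdsWithin_iff.2 ⟨hx1, ?_⟩
      filter_upwards [hxf] with ε h
      exact h.1.2.ne
    have h := (hs.comp hx1').mul hd1.neg
    rw [one_mul] at h
    refine h.congr' ?_
    filter_upwards [hpos, hxf] with ε hε h
    have : xf ε - 1 ≠ 0 := by linarith [h.1.2] |> fun (h : xf ε - 1 < 0) => h.ne
    simp only [Function.comp, slope_def_field, Real.log_one, sub_zero]
    field_simp
    ring
  have hfl : Tendsto (fun ε : ℝ => (⌊S / ε⌋₊ : ℝ) * ε) l (nhds S) := by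
    have h := (tendsto_nat_floor_mul_div_atTop (R := ℝ) hS.le).comp
      (tendsto_inv_nhdsGT_zero (𝕜 := ℝ))
    refine h.congr' ?_
    filter_upwards with ε
    simp [Function.comp, div_eq_mul_inv]
  have hy : Tendsto (fun ε => xf ε ^ ⌊S / ε⌋₊) l (nhds (Real.exp (-a * S))) := by
    have h := (Real.continuous_exp.tendsto _).comp (hlog.mul hfl)
    refine h.congr' ?_
    filter_upwards [hpos, hxpos] with ε hε hx
    simp only [Function.comp]
    rw [← Real.exp_log (pow_pos hx _), Real.log_pow]
    congr 1
    field_simp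
  have hY : Real.exp (-a * S) < 1 := by
    rw [Real.exp_lt_one_iff]
    nlinarith [mul_pos ha hS]
  have hYY : Real.exp (-2 * a * S) = Real.exp (-a * S) ^ 2 := by
    rw [← Real.exp_nat_mul]; congr 1; push_cast; ring
  rw [hYY]
  generalize Real.exp (-a * S) = Y at *
  have hD : Tendsto (fun ε => (1 - xf ε * xf ε ^ ⌊S / ε⌋₊) * (1 - xf ε ^ 2 * xf ε ^ ⌊S / ε⌋₊)) l
      (nhds ((1 - Y) ^ 2)) := by
    have h := ((hx1.mul hy).const_sub 1).mul (((hx1.pow 2).mul hy).const_sub 1)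
    convert h using 2; ring
  have hY1 : (1 - Y) ≠ 0 := by linarith [hY] |> fun (h : 0 < 1 - Y) => h.ne'
  have hY2 : (1 - Y) ^ 2 ≠ 0 := pow_ne_zero 2 hY1
  have hmain := (hd2.mul ((hp.inv₀ (by norm_num)).add
    (((hq.div hp (by norm_num)).mul (hy.mul (hx1.const_add 1))).div hD hY2))).neg
  have e : -(a ^ 2 * (1 + 10 * Y + Y ^ 2)) / (3 * (1 - Y) ^ 2) =
      -(a ^ 2 * (3⁻¹ + 6 / 3 * (Y * (1 + 1)) / (1 - Y) ^ 2)) := by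
    field_simp; ring
  rw [e]
  refine hmain.congr' ?_
  filter_upwards [hpos, hxpos, hD.eventually_ne hY2] with ε hε hx hDne
  simp only [Pi.div_apply]
  unfold Rfun
  simp only [pow_add]
  generalize xf ε ^ ⌊S / ε⌋₊ = y at *
  generalize xf ε = x at *
  have hpp : 1 + x + x ^ 2 ≠ 0 := by positivity
  rw [show (1 - y * x ^ 1) * (1 - y * x ^ 2) = (1 - x * y) * (1 - x ^ 2 * y) by ring]
  have hN : (1 - y) * (1 - y * x ^ 3) =
    (1 - x * y) * (1 - x ^ 2 * y) - y * (1 - x) ^ 2 * (1 + x) := by ring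
  rw [hN]
  generalize (1 - x * y) * (1 - x ^ 2 * y) = D at *
  field_simp
  ring
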